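/- Let A be a ring, S = A[t_1,…,t_n; σ, δ], and a, b ∈ A^n such that b·x = σ(x)·a + δ(x) for some x ∈ A which is not a zero divisor. Then (1) for every f ∈ S and y ∈ A, f(T_b)(y)·x = f(T_a)(y·x); and (2) x ∈ ker f(T_a) if and only if f(b) = 0. -/

import Mathlib

structure OreExtension (A : Type*) [Ring A] (n : ℕ)
    (σ : A →+* Matrix (Fin n) (Fin n) A) (δ : Fin n → A →+ A) : Type _ where
  S : Type*
  [ringS : Ring S]
  ι : A →+* S
  t : Fin n → S
  commute_rule : ∀ (i : Fin n) (a : A),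
    t i * ι a = (∑ j, ι (σ a i j) * t j) + ι (δ i a)
  unique_repr : ∀ s : S, ∃! c : FreeMonoid (Fin n) →₀ A,
    s = c.sum fun w x => ι x * (List.map t (FreeMonoid.toList w)).prod

attribute [instance] OreExtension.ringS

/-- Induction principle: an Ore extension is generated as a ring by its coefficients and
variables. -/
theorem OreExtension.induction_on {A : Type*} [Ring A] {n : ℕ}
    {σ : A →+* Matrix (Fin n) (Fin n) A} {δ : Fin n → A →+ A}
    (e : OreExtension A n σ δ) {p : e.S → Prop} (f : e.S)
    (hι : ∀ c, p (e.ι c)) (ht : ∀ i, p (e.t i))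
    (hadd : ∀ f g, p f → p g → p (f + g)) (hmul : ∀ f g, p f → p g → p (f * g)) : p f := by
  obtain ⟨c, rfl, -⟩ := e.unique_repr f
  have hzero : p 0 := by simpa using hι 0
  have hone : p 1 := by simpa using hι 1
  refine Finset.sum_induction _ p hadd hzero fun w _ => hmul _ _ (hι _) ?_
  refine List.prod_induction p (fun {f g} => hmul f g) hone fun s hs => ?_
  obtain ⟨i, -, rfl⟩ := List.mem_map.mp hs
  exact ht i

/-- The product rule for pseudo-multilinear transformations. -/
theorem pmt_mul_right {A : Type*} [Ring A] {n : ℕ}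
    (σ : A →+* Matrix (Fin n) (Fin n) A) (δ : Fin n → A →+ A)
    (hδ : ∀ (i : Fin n) (c d : A), δ i (c * d) = (∑ j, σ c i j * δ j d) + δ i c * d)
    (a b : Fin n → A) (x : A)
    (hbx : ∀ i : Fin n, b i * x = (∑ j, σ x i j * a j) + δ i x) (i : Fin n) (y : A) :
    ((∑ j, σ y i j * b j) + δ i y) * x = (∑ j, σ (y * x) i j * a j) + δ i (y * x) := by
  have hσ : ∑ j, σ (y * x) i j * a j = ∑ j, σ y i j * ∑ k, σ x j k * a k := by
    simp only [map_mul, Matrix.mul_apply, Finset.sum_mul, Finset.mul_sum, mul_assoc]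
    exact Finset.sum_comm
  simp only [add_mul, Finset.sum_mul, mul_assoc, hbx, hδ, hσ, mul_add, Finset.sum_add_distrib,
    add_assoc]

/-- Let `a, b ∈ Aⁿ` with `b x = σ(x) a + δ(x)` for some non-zero-divisor `x ∈ A`,
and let `φ_a, φ_b : S → End(A,+)` be the ring homomorphisms attached to the
pseudo-multilinear transformations `T_a, T_b`.  Then
(1) `f(T_b)(y) x = f(T_a)(y x)` for all `f ∈ S`, `y ∈ A`; and
(2) `x ∈ ker f(T_a)` iff `f(b) = 0` (with `f(b) = f(T_b)(1)`). -/
theorem pmt_conjugation {A : Type*} [Ring A] {n : ℕ}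
    (σ : A →+* Matrix (Fin n) (Fin n) A) (δ : Fin n → A →+ A)
    (hδ : ∀ (i : Fin n) (c d : A), δ i (c * d) = (∑ j, σ c i j * δ j d) + δ i c * d)
    (e : OreExtension A n σ δ) (a b : Fin n → A) (x : A)
    (hreg_left : ∀ y : A, x * y = 0 → y = 0)
    (hreg_right : ∀ y : A, y * x = 0 → y = 0)
    (hbx : ∀ i : Fin n, b i * x = (∑ j, σ x i j * a j) + δ i x)
    (φa φb : e.S →+* AddMonoid.End A)
    (hφaι : ∀ c y : A, φa (e.ι c) y = c * y)
    (hφat : ∀ (i : Fin n) (y : A), φa (e.t i) y = (∑ j, σ y i j * a j) + δ i y)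
    (hφbι : ∀ c y : A, φb (e.ι c) y = c * y)
    (hφbt : ∀ (i : Fin n) (y : A), φb (e.t i) y = (∑ j, σ y i j * b j) + δ i y) :
    (∀ (f : e.S) (y : A), φb f y * x = φa f (y * x)) ∧
    (∀ f : e.S, φa f x = 0 ↔ φb f 1 = 0) := by
  have hcomm : ∀ (f : e.S) (y : A), φb f y * x = φa f (y * x) := by
    intro f
    induction f using e.induction_on with
    | hι c => intro y; rw [hφbι, hφaι, mul_assoc]
    | ht i => intro y; rw [hφbt, hφat, pmt_mul_right σ δ hδ a b x hbx]
    | hadd f g hf hg =>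
      intro y
      rw [map_add, map_add]
      exact (add_mul (φb f y) (φb g y) x).trans (congrArg₂ _ (hf y) (hg y))
    | hmul f g hf hg => intro y; simp [hf, hg]
  refine ⟨hcomm, fun f => ?_⟩
  have h := hcomm f 1
  rw [one_mul] at h
  rw [← h]
  exact ⟨hreg_right _, fun h₀ => by rw [h₀, zero_mul]⟩
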